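/- There exists a subset S of the Brauer algebra Br(F4) of cardinality at most 14985 which spans Br(F4) as a ℤ[δ,δ⁻¹]-module. -/

import Mathlib

open LaurentPolynomial

/-- The base ring `ℤ[δ, δ⁻¹]` of Laurent polynomials over `ℤ`. -/
abbrev Rring : Type := LaurentPolynomial ℤ

/-- The distinguished invertible element `δ`. -/
noncomputable def δ : Rring := LaurentPolynomial.T 1

/-- Generators of the Brauer algebra of type F₄: `r i` and `e i` for the four nodes
(the node `i : Fin 4` corresponds to the node `i+1` in the usual 1-based labelling). -/
inductive GenF4 : Type
  | r : Fin 4 → GenF4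
  | e : Fin 4 → GenF4

namespace BrF4rel

/-- `R i` in the free algebra. -/
noncomputable abbrev R (i : Fin 4) : FreeAlgebra Rring GenF4 := FreeAlgebra.ι Rring (GenF4.r i)
/-- `E i` in the free algebra. -/
noncomputable abbrev E (i : Fin 4) : FreeAlgebra Rring GenF4 := FreeAlgebra.ι Rring (GenF4.e i)

/-- Non-adjacent (0-based) pairs of nodes of the F₄ diagram: `{1,3}, {1,4}, {2,4}` 1-based. -/
def nadj (i j : Fin 4) : Prop :=
  (i, j) ∈ ([(0, 2), (2, 0), (0, 3), (3, 0), (1, 3), (3, 1)] : List (Fin 4 × Fin 4))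

/-- Simply bonded (0-based) pairs of nodes of the F₄ diagram: `{1,2}, {3,4}` 1-based. -/
def sadj (i j : Fin 4) : Prop :=
  (i, j) ∈ ([(0, 1), (1, 0), (2, 3), (3, 2)] : List (Fin 4 × Fin 4))

/-- The defining relations of the Brauer algebra of type F₄ (0-based node labels:
node `i` here is node `i+1` in the paper). -/
inductive rel : FreeAlgebra Rring GenF4 → FreeAlgebra Rring GenF4 → Prop
  | rr (i : Fin 4) : rel (R i * R i) 1
  | re (i : Fin 4) : rel (R i * E i) (E i)
  | er (i : Fin 4) : rel (E i * R i) (E i)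
  | ee_short (i : Fin 4) (h : i = 2 ∨ i = 3) : rel (E i * E i) (δ • E i)
  | ee_long (i : Fin 4) (h : i = 0 ∨ i = 1) : rel (E i * E i) ((δ ^ 2) • E i)
  | rr_comm {i j : Fin 4} (h : nadj i j) : rel (R i * R j) (R j * R i)
  | er_comm {i j : Fin 4} (h : nadj i j) : rel (E i * R j) (R j * E i)
  | ee_comm {i j : Fin 4} (h : nadj i j) : rel (E i * E j) (E j * E i)
  | braid {i j : Fin 4} (h : sadj i j) : rel (R i * R j * R i) (R j * R i * R j)
  | rre {i j : Fin 4} (h : sadj i j) : rel (R j * R i * E j) (E i * E j)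
  | rer {i j : Fin 4} (h : sadj i j) : rel (R i * E j * R i) (R j * E i * R j)
  | db1 : rel (R 1 * R 2 * R 1 * R 2) (R 2 * R 1 * R 2 * R 1)
  | db2 : rel (R 1 * R 2 * E 1) (R 2 * E 1)
  | db3 : rel (R 1 * E 2 * R 1 * E 2) (E 2 * E 1 * E 2)
  | db4 : rel (R 1 * R 2 * R 1 * E 2) (E 2 * (R 1 * R 2 * R 1))
  | db5 : rel (E 1 * R 2 * E 1) (δ • E 1)
  | db6 : rel (E 1 * E 2 * E 1) (δ • E 1)
  | db7 : rel (E 1 * R 2 * R 1) (E 1 * R 2)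
  | db8 : rel (E 1 * E 2 * R 1) (E 1 * E 2)

end BrF4rel

/-- The Brauer algebra of type F₄ over `ℤ[δ, δ⁻¹]`. -/
noncomputable abbrev BrF4 : Type := RingQuot BrF4rel.rel

/-- The generator `r i` (0-based) of `BrF4`. -/
noncomputable def rgen (i : Fin 4) : BrF4 :=
  RingQuot.mkAlgHom Rring BrF4rel.rel (BrF4rel.R i)

/-- The generator `e i` (0-based) of `BrF4`. -/
noncomputable def egen (i : Fin 4) : BrF4 :=
  RingQuot.mkAlgHom Rring BrF4rel.rel (BrF4rel.E i)

namespace BrF4Span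

/-- A word in the eight generators: the letters `0, …, 3` stand for `r₁, …, r₄` and the letters
`4, …, 7` for `e₁, …, e₄`. -/
abbrev Word := List ℕ

/-! ### A string rewriting procedure

Rewriting rules are stored in a trie that is indexed by the reversed left-hand sides. The functions
which are iterated pass their results to a continuation, so that the kernel evaluates them
eagerly. -/

/-- A set of rewriting rules, as a trie of reversed left-hand sides in first-child, next-sibling
form. The field `rhs` holds the right-hand side of the rule that ends at the node. -/
inductive Trie : Type
  | nil : Trie
  | node (x : ℕ) (rhs : Option Word) (child next : Trie) : Trie

/-- Equality test for words. -/
def beq : Word → Word → Bool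
  | [], [] => true
  | x :: v, y :: w => bif Nat.beq x y then beq v w else false
  | _, _ => false

/-- Lexicographic comparison of words of equal length. -/
def lexLt : Word → Word → Bool
  | x :: v, y :: w => bif Nat.beq x y then lexLt v w else Nat.blt x y
  | _, _ => false

/-- The shortlex order on words. -/
def shortlexLt (v w : Word) : Bool :=
  bif Nat.beq v.length w.length then lexLt v w else Nat.blt v.length w.length

/-- Does `f` occur in the given word as a factor? -/
def occurs (f : Word) : Word → Bool
  | [] => false
  | x :: w => f.isPrefixOf (x :: w) || occurs f w

/-- The trie that holds one rule. -/
def Trie.single (r : Word) : ℕ → Word → Trie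
  | x, [] => .node x (some r) .nil .nil
  | x, y :: k => .node x none (single r y k) .nil

/-- Insert the rule with reversed left-hand side `k` and right-hand side `r`. -/
def Trie.insert (r : Word) : Trie → Word → (Trie → Bool) → Bool
  | t, [], c => c t
  | .nil, x :: k, c => c (.single r x k)
  | .node y v ch nx, x :: k, c =>
    bif Nat.beq x y then
      match k with
      | [] => c (.node y (some r) ch nx)
      | _ :: _ => ch.insert r k fun ch' => c (.node y v ch' nx)
    else nx.insert r (x :: k) fun nx' => c (.node y v ch nx')

/-- Find the shortest reversed left-hand side at the start of the given word; return the
right-hand side together with the unused part of the word. -/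
def Trie.find : Trie → Word → Option (Word × Word)
  | .nil, _ => none
  | .node _ _ _ _, [] => none
  | .node y v ch nx, x :: s =>
    bif Nat.beq x y then
      match v with
      | some r => some (r, s)
      | none => ch.find s
    else nx.find (x :: s)

/-- Rewrite the word `s.reverse ++ w`, where no rule applies to `s.reverse`. -/
def Trie.reduce (t : Trie) : ℕ → Word → Word → Word
  | 0, s, w => s.reverseAux w
  | _ + 1, s, [] => s.reverseAux []
  | n + 1, s, x :: w =>
    match t.find (x :: s) with
    | some (r, s') => t.reduce n s' (r ++ w)
    | none => t.reduce n (x :: s) w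

/-- The normal form of a word with respect to the rules in `t`. -/
def Trie.nf (t : Trie) (w : Word) : Word := t.reduce 1000 [] w

/-- Evaluate a word completely before passing it on. -/
def force (c : Word → Bool) : Word → Word → Bool
  | [], acc => c (acc.reverseAux [])
  | x :: w, acc => force c w (x :: acc)

/-- Add the rule that results from an equation between two words. -/
def Trie.learn (t : Trie) (v w : Word) (c : Trie → Bool) : Bool :=
  force (fun v => force (fun w =>
    bif beq v w then c t
    else bif shortlexLt v w then t.insert v (w.reverseAux []) c
    else t.insert w (v.reverseAux []) c) (t.nf w) []) (t.nf v) []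

/-- Learn all given equations. -/
def Trie.learnAll (c : Trie → Bool) : List (Word × Word) → Trie → Bool
  | [], t => c t
  | (v, w) :: l, t => t.learn v w (learnAll c l)

/-- For every given pair `(p, q)` learn the equation that results from reducing `p ++ q` in two
ways, beginning on the left and beginning with `q`. -/
def Trie.complete (c : Trie → Bool) : List (Word × Word) → Trie → Bool
  | [], t => c t
  | (p, q) :: l, t => t.learn (p ++ q) (p ++ t.nf q) (complete c l)

/-- Do the two words have the same normal form? -/
def Trie.eqv (t : Trie) (v w : Word) : Bool := beq (t.nf v) (t.nf w)

/-- Does the word have the same normal form as one in the list? -/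
def Trie.mem (t : Trie) (v : Word) (l : List Word) : Bool :=
  force (fun v => l.any fun w => beq v (t.nf w)) (t.nf v) []

/-! ### The presentation and the tables -/

/-- The defining relations, with `δ` set to `1`. -/
def rels : List (Word × Word) :=
  [([0, 0], []), ([0, 4], [4]), ([4, 0], [4]), ([4, 4], [4]), ([1, 1], []), ([1, 5], [5]),
   ([5, 1], [5]), ([5, 5], [5]), ([2, 2], []), ([2, 6], [6]), ([6, 2], [6]), ([6, 6], [6]),
   ([3, 3], []), ([3, 7], [7]), ([7, 3], [7]), ([7, 7], [7]), ([0, 2], [2, 0]), ([4, 2], [2, 4]),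
   ([4, 6], [6, 4]), ([2, 0], [0, 2]), ([6, 0], [0, 6]), ([6, 4], [4, 6]), ([0, 3], [3, 0]),
   ([4, 3], [3, 4]), ([4, 7], [7, 4]), ([3, 0], [0, 3]), ([7, 0], [0, 7]), ([7, 4], [4, 7]),
   ([1, 3], [3, 1]), ([5, 3], [3, 5]), ([5, 7], [7, 5]), ([3, 1], [1, 3]), ([7, 1], [1, 7]),
   ([7, 5], [5, 7]), ([0, 1, 0], [1, 0, 1]), ([1, 0, 5], [4, 5]), ([0, 5, 0], [1, 4, 1]),
   ([1, 0, 1], [0, 1, 0]), ([0, 1, 4], [5, 4]), ([1, 4, 1], [0, 5, 0]), ([2, 3, 2], [3, 2, 3]),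
   ([3, 2, 7], [6, 7]), ([2, 7, 2], [3, 6, 3]), ([3, 2, 3], [2, 3, 2]), ([2, 3, 6], [7, 6]),
   ([3, 6, 3], [2, 7, 2]), ([1, 2, 1, 2], [2, 1, 2, 1]), ([1, 2, 5], [2, 5]),
   ([1, 6, 1, 6], [6, 5, 6]), ([1, 2, 1, 6], [6, 1, 2, 1]), ([5, 2, 5], [5]), ([5, 6, 5], [5]),
   ([5, 2, 1], [5, 2]), ([5, 6, 1], [5, 6])]

/-- Overlaps whose resolution yields all the rewriting rules needed. -/
def overlaps : List (Word × Word) :=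
  [([4], [2, 6]), ([3], [0, 4]), ([4], [3, 7]), ([3], [1, 5]), ([6], [4, 3]), ([7], [4, 2]),
   ([4], [3, 1]), ([1], [1, 0, 5]), ([0], [0, 1, 4]), ([3], [3, 2, 7]), ([2], [2, 3, 6]),
   ([5], [1, 0, 5]), ([4], [0, 1, 4]), ([7], [3, 2, 7]), ([6], [2, 3, 6]), ([1], [1, 4, 1]),
   ([4, 5], [0, 0]), ([3], [3, 6, 3]), ([6, 7], [2, 2]), ([0], [1, 4, 5]), ([1], [0, 5, 4]),
   ([2], [3, 6, 7]), ([3], [2, 7, 6]), ([6], [4, 1, 4]), ([2], [0, 1, 4]), ([0, 1], [4, 2]),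
   ([6], [0, 1, 4]), ([3], [0, 1, 4]), ([3, 2], [7, 5]), ([3, 2], [7, 1]), ([4], [2, 3, 6]),
   ([3], [1, 2, 5]), ([1, 2], [5, 3]), ([7], [1, 2, 5]), ([5], [1, 4, 1]), ([5, 4], [1, 1]),
   ([7], [3, 6, 3]), ([7, 6], [3, 3]), ([5], [3, 4, 7]), ([2], [0, 5, 4]), ([6], [0, 5, 4]),
   ([3], [0, 5, 4]), ([3, 6], [7, 5]), ([3, 6], [7, 1]), ([4], [2, 7, 6]), ([7, 2], [3, 1]),
   ([3, 2], [3, 1]), ([3, 6], [3, 1]), ([1], [1, 6, 1, 6]), ([6], [4, 5, 4]), ([7, 6], [7, 1]),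
   ([1, 6], [5, 6, 5]), ([6, 1, 2], [1, 1]), ([6, 3], [4, 1, 4]), ([7, 2], [4, 1, 4]),
   ([7], [4, 6, 1, 4]), ([1, 6], [5, 6, 1]), ([4, 6, 5], [4, 3]), ([6], [1, 6, 1, 6]),
   ([6], [5, 6, 5]), ([3], [1, 6, 5]), ([1, 6], [5, 3]), ([7], [1, 6, 5]), ([6, 5], [6, 4]),
   ([1, 0], [1, 2, 5]), ([5, 2], [1, 0, 1]), ([1, 6, 1], [6, 4]), ([3], [0, 2, 1, 4]),
   ([0, 2, 1], [4, 3]), ([7], [0, 2, 1, 4]), ([6], [0, 1, 2, 4]), ([3], [0, 6, 1, 4]),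
   ([0, 6, 1], [4, 3]), ([7], [0, 6, 1, 4]), ([3, 2, 5], [7, 4]), ([3, 2, 1], [7, 4]),
   ([3, 2, 1], [7, 0]), ([1, 3, 2], [5, 3]), ([3], [0, 2, 5, 4]), ([0, 2, 5], [4, 3]),
   ([7], [0, 2, 5, 4]), ([3], [0, 6, 5, 4]), ([0, 6, 5], [4, 3]), ([3, 6, 5], [7, 4]),
   ([3, 6, 1], [7, 4]), ([1], [1, 2, 1, 6, 1]), ([1, 0], [1, 6, 5]), ([1, 3, 6], [5, 3]),
   ([4], [2, 1, 2, 1]), ([4, 1], [3, 2, 3]), ([4, 1], [3, 6, 3]), ([7, 2], [4, 5, 4]),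
   ([3, 2, 1], [3, 0]), ([6, 3], [6, 1, 2, 1]), ([4, 5], [0, 2, 1, 4]), ([4, 1, 2, 1], [4, 3]),
   ([7], [4, 1, 2, 1, 4]), ([4, 5], [0, 6, 1, 4]), ([4, 1, 6, 1], [4, 3]),
   ([0, 1], [0, 2, 5, 4]), ([4], [5, 0, 2, 1, 0]), ([0, 1], [0, 6, 5, 4]),
   ([2, 3], [6, 1, 2, 1]), ([2, 7], [6, 1, 2, 1]), ([6, 7], [2, 1, 2, 1]),
   ([6, 3], [2, 1, 2, 1]), ([4, 1], [3, 2, 1, 7]), ([4, 1], [3, 6, 1, 7]),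
   ([1, 3], [6, 5, 4, 6]), ([1, 7], [6, 5, 4, 6]), ([2], [0, 3, 2, 1, 4]),
   ([2], [0, 7, 2, 1, 4]), ([0, 6, 1, 2], [4, 3]), ([2], [0, 3, 2, 5, 4]),
   ([2], [0, 7, 2, 5, 4]), ([6, 7], [2, 1, 6, 1]), ([3], [0, 1, 2, 1, 4]),
   ([0, 1, 2, 1], [4, 3]), ([7], [0, 1, 2, 1, 4]), ([3], [0, 1, 6, 1, 4]),
   ([0, 1, 6, 1], [4, 3]), ([2, 1, 2], [1, 0, 1]), ([6, 7], [6, 1, 2, 1]),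
   ([3, 2, 1], [3, 2, 3]), ([2, 1, 6], [1, 0, 1]), ([6, 1, 3, 2, 1], [6, 4]),
   ([6, 1, 7, 2, 1], [6, 4]), ([3, 2, 1], [3, 2, 1, 7]), ([4, 1, 2, 1], [2, 7, 6]),
   ([2, 1, 3, 2, 1], [6, 4]), ([2, 1, 7, 2, 1], [6, 4]), ([2], [0, 1, 3, 2, 1, 4]),
   ([6], [0, 1, 3, 2, 1, 4]), ([0, 1, 3, 2, 1], [4, 3]), ([2], [0, 1, 7, 2, 1, 4]),
   ([2], [0, 1, 3, 6, 1, 4]), ([0, 1, 3, 6, 1], [4, 3]), ([3, 2, 1, 0], [3, 2, 3]),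
   ([2, 1], [6, 1, 3, 2, 1, 6]), ([1], [1, 6, 1, 2, 3, 2, 1, 6]), ([6, 1, 2, 3, 2, 1], [6, 4]),
   ([6, 1, 7, 6, 1], [2, 3, 6]), ([6, 1, 2, 7, 2, 1], [6, 4]), ([2, 1, 3, 2, 1], [2, 7, 6]),
   ([2], [2, 1, 2, 3, 2, 1, 6]), ([2, 1, 2, 3, 2, 1], [6, 4]), ([2, 1, 2, 7, 2, 1], [6, 4]),
   ([4, 1, 2, 1], [0, 3, 2, 1, 4]), ([4, 1, 2, 1], [0, 7, 2, 1, 4]),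
   ([3], [4, 1, 2, 1, 7, 2, 1, 4]), ([4, 1, 6, 1, 7, 2, 1], [4, 2]),
   ([4, 1, 6, 1, 7, 2, 1], [4, 3]), ([3], [4, 1, 6, 1, 7, 6, 1, 4]),
   ([2], [4, 1, 2, 1, 7, 6, 1, 4]), ([3, 2, 1, 0, 2, 3], [2, 1, 2, 1]),
   ([3, 2, 1, 0, 2, 1, 3, 2, 1], [2, 0])]

/-- Words for the elements of the left ideal generated by `e₁e₃`. -/
def leftE1E3 : List Word :=
  [[4, 6], [1, 4, 6], [3, 4, 6], [5, 4, 6], [4, 7, 6], [2, 1, 4, 6], [1, 3, 4, 6], [6, 1, 4, 6],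
   [1, 4, 7, 6], [3, 5, 4, 6], [2, 5, 4, 6], [5, 4, 7, 6], [1, 2, 1, 4, 6], [3, 2, 1, 4, 6],
   [7, 2, 1, 4, 6], [2, 1, 3, 4, 6], [6, 1, 3, 4, 6], [3, 6, 1, 4, 6], [7, 6, 1, 4, 6],
   [2, 1, 4, 7, 6], [6, 1, 4, 7, 6], [2, 3, 5, 4, 6], [6, 3, 5, 4, 6], [3, 2, 5, 4, 6],
   [7, 2, 5, 4, 6], [2, 5, 4, 7, 6], [6, 5, 4, 7, 6], [1, 3, 2, 1, 4, 6], [1, 7, 2, 1, 4, 6],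
   [2, 3, 2, 1, 4, 6], [2, 7, 2, 1, 4, 6], [1, 2, 1, 3, 4, 6], [1, 6, 1, 3, 4, 6],
   [1, 2, 1, 4, 7, 6], [1, 6, 1, 4, 7, 6], [2, 3, 2, 5, 4, 6], [2, 7, 2, 5, 4, 6],
   [1, 2, 3, 2, 1, 4, 6], [1, 2, 7, 2, 1, 4, 6]]

/-- Together with `symE1`, representatives for the left ideal generated by `e₁`. -/
def leftE1 : List Word :=
  [[], [1], [5], [2, 1], [2, 5], [6, 1], [6, 5], [1, 2, 1], [1, 6, 1], [3, 2, 1], [3, 2, 5],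
   [3, 6, 1], [3, 6, 5], [7, 2, 1], [7, 2, 5], [1, 3, 2, 1], [1, 3, 6, 1], [1, 7, 2, 1],
   [2, 1, 3, 2, 1], [2, 1, 3, 6, 1], [2, 1, 7, 2, 1], [6, 1, 3, 2, 1], [1, 2, 1, 3, 2, 1],
   [1, 2, 1, 3, 6, 1], [1, 2, 1, 7, 2, 1], [1, 6, 1, 3, 2, 1], [0, 1, 2, 1, 3, 2, 1],
   [0, 1, 2, 1, 3, 6, 1], [0, 1, 2, 1, 7, 2, 1], [0, 1, 6, 1, 3, 2, 1]]

/-- Words for the elements of the subgroup generated by `r₃` and `r₄`. -/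
def symE1 : List Word :=
  [[], [2], [3], [2, 3], [3, 2], [2, 3, 2]]

/-- Words that take `e₃` to all its conjugates. -/
def conjE3 : List Word :=
  [[], [1], [3], [0, 1], [1, 3], [2, 3], [0, 1, 3], [2, 1, 3], [0, 2, 1, 3], [1, 0, 2, 1, 3],
   [2, 1, 0, 2, 1, 3], [3, 2, 1, 0, 2, 1, 3]]

/-- Coset representatives of `⟨r₂, r₃, r₄⟩` in `⟨r₁, r₂, r₃, r₄⟩`. -/
def cosets₁ : List Word :=
  [[], [0], [1, 0], [2, 1, 0], [1, 2, 1, 0], [3, 2, 1, 0], [0, 1, 2, 1, 0], [1, 3, 2, 1, 0],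
   [0, 1, 3, 2, 1, 0], [2, 1, 3, 2, 1, 0], [0, 2, 1, 3, 2, 1, 0], [1, 2, 1, 3, 2, 1, 0],
   [1, 0, 2, 1, 3, 2, 1, 0], [0, 1, 2, 1, 3, 2, 1, 0], [0, 1, 0, 2, 1, 3, 2, 1, 0],
   [2, 1, 0, 2, 1, 3, 2, 1, 0], [0, 2, 1, 0, 2, 1, 3, 2, 1, 0], [3, 2, 1, 0, 2, 1, 3, 2, 1, 0],
   [1, 0, 2, 1, 0, 2, 1, 3, 2, 1, 0], [0, 3, 2, 1, 0, 2, 1, 3, 2, 1, 0],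
   [1, 0, 3, 2, 1, 0, 2, 1, 3, 2, 1, 0], [2, 1, 0, 3, 2, 1, 0, 2, 1, 3, 2, 1, 0],
   [1, 2, 1, 0, 3, 2, 1, 0, 2, 1, 3, 2, 1, 0], [0, 1, 2, 1, 0, 3, 2, 1, 0, 2, 1, 3, 2, 1, 0]]

/-- Coset representatives of `⟨r₂, r₃⟩` in `⟨r₂, r₃, r₄⟩`. -/
def cosets₂ : List Word :=
  [[], [3], [2, 3], [1, 2, 3], [2, 1, 2, 3], [3, 2, 1, 2, 3]]

/-- Coset representatives of `⟨r₃⟩` in `⟨r₂, r₃⟩`. -/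
def cosets₃ : List Word :=
  [[], [1], [2, 1], [1, 2, 1]]

/-- Is `D` closed under left multiplication by the letters in `X`, up to right multiplication by
letters in `P`? -/
def checkCosets (t : Trie) (X : List ℕ) (D : List Word) (P : List ℕ) : Bool :=
  D.all fun d => X.all fun x => t.mem (x :: d) D || t.mem (x :: d) (P.map fun p => d ++ [p])

/-- Do the reversed relations hold? -/
def checkOpp (t : Trie) : Bool := rels.all fun p => t.eqv p.1.reverse p.2.reverse

/-- Equations that express `e₂`, `e₄` by the other generators, and that compare ideals. -/
def checkGen (t : Trie) : Bool :=
  t.eqv [5] [0, 1, 4, 1, 0] && t.eqv [7] [2, 3, 6, 3, 2] && t.eqv [4, 7] [2, 3, 4, 6, 3, 2] &&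
  t.eqv [6, 1, 6] [1, 6, 0, 1, 4, 1, 0, 6] && t.eqv [4, 6] [4, 6, 6, 4]

/-- Is `leftE1E3` closed under left multiplication? -/
def checkE1E3 (t : Trie) : Bool :=
  leftE1E3.all fun w => [0, 1, 2, 3, 4, 6].all fun x => t.mem (x :: w) leftE1E3

/-- Are the products of `leftE1`, `symE1` and `e₁` closed under left multiplication, up to the
ideal generated by `e₁e₃`? -/
def checkE1 (t : Trie) : Bool :=
  leftE1.all fun v => [0, 1, 2, 3, 4, 6].all fun x =>
    occurs [4, 6] (t.nf (x :: (v ++ [4]))) || occurs [4, 7] (t.nf (x :: (v ++ [4]))) ||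
    leftE1.any fun v' => t.mem (x :: (v ++ [4])) (symE1.map fun h => v' ++ (h ++ [4]))

/-- Is `symE1` closed under multiplication, and does it commute with `e₁`? -/
def checkSym (t : Trie) : Bool :=
  symE1.all fun h => t.eqv (h ++ [4]) (4 :: h) && symE1.all fun h' => t.mem (h ++ h') symE1

/-- Does left multiplication by a reflection permute the cosets `conjE3` of the centralizer of
`e₃`? -/
def checkConj (t : Trie) : Bool :=
  conjE3.all fun u => [0, 1, 2, 3].all fun x => conjE3.any fun u' =>
    t.eqv (u'.reverse ++ x :: (u ++ [6])) (6 :: (u'.reverse ++ x :: u))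

/-- Is `e₃ u e₃`, for `u` in `conjE3`, in the ideal generated by `e₁` or of the form `w e₃`? -/
def checkE3 (t : Trie) : Bool :=
  conjE3.all fun u =>
    occurs [4] (t.nf (6 :: (u ++ [6]))) || occurs [6, 1, 6] (t.nf (6 :: (u ++ [6]))) ||
    t.mem (6 :: (u ++ [6])) [u ++ [6], u ++ 2 :: (u.reverse ++ 2 :: (u ++ [6]))]

/-- All checks together. -/
def check (t : Trie) : Bool :=
  checkOpp t && checkGen t && checkE1E3 t && checkE1 t && checkSym t && checkConj t &&
  checkE3 t &&
  checkCosets t [0, 1, 2, 3] cosets₁ [1, 2, 3] && checkCosets t [1, 2, 3] cosets₂ [1, 2] &&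
  checkCosets t [1, 2] cosets₃ [2]

/-! ### Soundness -/

section Soundness

variable {M : Type*} [Monoid M] {g : ℕ → M}

/-- The value of a word. -/
def ev (g : ℕ → M) (w : Word) : M := (w.map g).prod

@[simp] lemma ev_nil : ev g [] = 1 := rfl

@[simp] lemma ev_cons (x : ℕ) (w : Word) : ev g (x :: w) = g x * ev g w := by simp [ev]

@[simp] lemma ev_append (v w : Word) : ev g (v ++ w) = ev g v * ev g w := by simp [ev]

/-- All rules in the trie hold in `M`, where `k` is the part of the left-hand sides that was read
before reaching the trie. -/
def Trie.Sound (g : ℕ → M) : Trie → Word → Prop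
  | .nil, _ => True
  | .node x r ch nx, k => (∀ v ∈ r, ev g (x :: k) = ev g v) ∧ ch.Sound g (x :: k) ∧ nx.Sound g k

lemma beq_sound : ∀ {v w : Word}, beq v w = true → v = w
  | [], [], _ => rfl
  | x :: v, y :: w, h => by
    rw [beq, Bool.cond_eq_ite, Bool.ite_eq_true_distrib] at h
    split_ifs at h with hxy
    rw [Nat.eq_of_beq_eq_true hxy, beq_sound h]
  | [], _ :: _, h => by simp [beq] at h
  | _ :: _, [], h => by simp [beq] at h

lemma occurs_sound {f : Word} : ∀ {w : Word}, occurs f w = true → ∃ p q, w = p ++ f ++ q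
  | [], h => by simp [occurs] at h
  | x :: w, h => by
    rw [occurs, Bool.or_eq_true] at h
    rcases h with h | h
    · obtain ⟨q, hq⟩ := List.isPrefixOf_iff_prefix.1 h
      exact ⟨[], q, by simp [hq]⟩
    · obtain ⟨p, q, rfl⟩ := occurs_sound h
      exact ⟨x :: p, q, by simp⟩

lemma force_eq (c : Word → Bool) : ∀ w acc, force c w acc = c (acc.reverse ++ w)
  | [], acc => by simp [force]
  | x :: w, acc => by simp [force, force_eq c w]

lemma Trie.single_sound (r : Word) : ∀ (x : ℕ) (k l : Word),
    ev g ((x :: k).reverse ++ l) = ev g r → (single r x k).Sound g l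
  | x, [], l, h => ⟨by simpa using h, trivial, trivial⟩
  | x, y :: k, l, h =>
    ⟨by simp, single_sound r y k (x :: l) (by simpa [mul_assoc] using h), trivial⟩

lemma Trie.insert_sound (r : Word) : ∀ (t : Trie) (k l : Word) (c : Trie → Bool),
    t.insert r k c = true → t.Sound g l → ev g (k.reverse ++ l) = ev g r →
      ∃ t', t'.Sound g l ∧ c t' = true
  | .nil, [], c, _, hc, ht, _ => ⟨_, ht, hc⟩
  | .node _ _ _ _, [], c, _, hc, ht, _ => ⟨_, ht, hc⟩
  | .nil, x :: k, l, c, hc, _, h => ⟨_, single_sound r x k l h, hc⟩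
  | .node y v ch nx, x :: k, l, c, hc, ht, h => by
    obtain ⟨h₁, h₂, h₃⟩ := ht
    rw [insert.eq_def] at hc
    simp only [Bool.cond_eq_ite] at hc
    split_ifs at hc with hxy
    · obtain rfl := Nat.eq_of_beq_eq_true hxy
      match k with
      | [] => exact ⟨.node x (some r) ch nx, ⟨by simpa using h, h₂, h₃⟩, hc⟩
      | z :: k =>
        obtain ⟨ch', hs, hc⟩ := insert_sound r ch (z :: k) (x :: l) _ hc h₂
          (by simpa [mul_assoc] using h)
        exact ⟨.node x v ch' nx, ⟨h₁, hs, h₃⟩, hc⟩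
    · obtain ⟨nx', hs, hc⟩ := insert_sound r nx (x :: k) l _ hc h₃ h
      exact ⟨.node y v ch nx', ⟨h₁, h₂, hs⟩, hc⟩

lemma Trie.find_sound : ∀ (t : Trie) (s l : Word) {r s' : Word}, t.Sound g l →
    t.find s = some (r, s') → ev g (s.reverse ++ l) = ev g (s'.reverse ++ r)
  | .nil, s, l, r, s', _, h => by simp [find] at h
  | .node _ _ _ _, [], l, r, s', _, h => by simp [find] at h
  | .node y v ch nx, x :: s, l, r, s', ht, h => by
    obtain ⟨h₁, h₂, h₃⟩ := ht
    rw [find.eq_def] at h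
    simp only [Bool.cond_eq_ite] at h
    split_ifs at h with hxy
    · obtain rfl := Nat.eq_of_beq_eq_true hxy
      match v with
      | some v =>
        obtain ⟨rfl, rfl⟩ : v = r ∧ s = s' := by simpa using h
        simpa [mul_assoc] using congrArg (ev g s.reverse * ·) (h₁ v rfl)
      | none => simpa [mul_assoc] using find_sound ch s (x :: l) h₂ h
    · exact find_sound nx (x :: s) l h₃ h

lemma Trie.reduce_sound {t : Trie} (ht : t.Sound g []) : ∀ (n : ℕ) (s w : Word),
    ev g (t.reduce n s w) = ev g (s.reverse ++ w)
  | 0, s, w => by simp [reduce]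
  | n + 1, s, [] => by simp [reduce]
  | n + 1, s, x :: w => by
    rw [reduce]
    split
    · next r s' h =>
      have := find_sound t _ _ ht h
      simp only [List.reverse_cons, List.append_nil, ev_append, ev_cons, ev_nil, mul_one] at this
      simp [reduce_sound ht n, ← mul_assoc, this]
    · simp [reduce_sound ht n]

lemma Trie.nf_sound {t : Trie} (ht : t.Sound g []) (w : Word) : ev g (t.nf w) = ev g w := by
  simp [nf, reduce_sound ht]

lemma Trie.eqv_sound {t : Trie} (ht : t.Sound g []) {v w : Word} (h : t.eqv v w = true) :
    ev g v = ev g w := by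
  rw [← nf_sound ht v, beq_sound h, nf_sound ht]

lemma Trie.mem_sound {t : Trie} (ht : t.Sound g []) {v : Word} {l : List Word}
    (h : t.mem v l = true) : ∃ w ∈ l, ev g v = ev g w := by
  rw [mem, force_eq] at h
  obtain ⟨w, hw, h⟩ := List.any_eq_true.1 h
  exact ⟨w, hw, eqv_sound ht (by simpa [eqv] using h)⟩

lemma Trie.learn_sound {t : Trie} (ht : t.Sound g []) {v w : Word} {c : Trie → Bool}
    (h : ev g v = ev g w) (hc : t.learn v w c = true) : ∃ t', t'.Sound g [] ∧ c t' = true := by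
  simp only [learn, force_eq, Bool.cond_eq_ite, List.reverse_nil, List.nil_append] at hc
  by_cases h₁ : beq (t.nf v) (t.nf w) = true
  · exact ⟨t, ht, by simpa [h₁] using hc⟩
  by_cases h₂ : shortlexLt (t.nf v) (t.nf w) = true
  · simp only [h₁, h₂, if_true] at hc
    exact insert_sound _ _ _ _ _ hc ht (by simp [nf_sound ht, h])
  · simp only [h₁, h₂] at hc
    exact insert_sound _ _ _ _ _ hc ht (by simp [nf_sound ht, h])

lemma Trie.learnAll_sound {c : Trie → Bool} : ∀ {l : List (Word × Word)} {t : Trie},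
    t.Sound g [] → (∀ p ∈ l, ev g p.1 = ev g p.2) → learnAll c l t = true →
      ∃ t', t'.Sound g [] ∧ c t' = true
  | [], t, ht, _, hc => ⟨t, ht, hc⟩
  | (v, w) :: l, t, ht, hl, hc => by
    rw [List.forall_mem_cons] at hl
    obtain ⟨t', ht', hc⟩ := learn_sound ht hl.1 hc
    exact learnAll_sound ht' hl.2 hc

lemma Trie.complete_sound {c : Trie → Bool} : ∀ {l : List (Word × Word)} {t : Trie},
    t.Sound g [] → complete c l t = true → ∃ t', t'.Sound g [] ∧ c t' = true
  | [], t, ht, hc => ⟨t, ht, hc⟩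
  | (p, q) :: l, t, ht, hc => by
    obtain ⟨t', ht', hc⟩ := learn_sound ht (by simp [nf_sound ht]) hc
    exact complete_sound ht' hc

lemma complete_check : Trie.learnAll (Trie.complete check overlaps) rels .nil = true := by
  decide +kernel

lemma exists_sound_trie (hg : ∀ p ∈ rels, ev g p.1 = ev g p.2) :
    ∃ t : Trie, t.Sound g [] ∧ check t = true := by
  obtain ⟨t, ht, hc⟩ := Trie.learnAll_sound (g := g) (t := .nil) trivial hg complete_check
  exact Trie.complete_sound ht hc

end Soundness

/-! ### The spanning words -/

/-- Representatives of `⟨r₁, r₂, r₃, r₄⟩` modulo `⟨r₃⟩`. -/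
def weyl : List Word :=
  (cosets₁ ×ˢ cosets₂ ×ˢ cosets₃).map fun p => p.1 ++ (p.2.1 ++ p.2.2)

/-- Words which represent all elements of the monoid. -/
def spanningWords : List Word :=
  weyl ++ weyl.map (fun k => k ++ [2]) ++
  (weyl ×ˢ conjE3).map (fun p => p.1 ++ 6 :: p.2.reverse) ++
  (leftE1 ×ˢ symE1 ×ˢ leftE1).map (fun p => p.1 ++ (p.2.1 ++ 4 :: p.2.2.reverse)) ++
  (leftE1E3 ×ˢ leftE1E3).map (fun p => p.1 ++ p.2.reverse)

lemma length_spanningWords : spanningWords.length = 14985 := by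
  simp only [spanningWords, weyl, List.length_append, List.length_map, List.length_product]
  decide

/-! ### Models of the presentation -/

section Model

variable {M : Type*} [Monoid M] {g : ℕ → M}

/-- `M` is a quotient of the monoid with the eight generators and the relations `rels`. -/
structure IsModel (g : ℕ → M) : Prop where
  ev_eq : ∀ p ∈ rels, ev g p.1 = ev g p.2
  eq_one : ∀ x, 8 ≤ x → g x = 1
  surj : ∀ m, ∃ w, ev g w = m

lemma ev_op (g : ℕ → M) (w : Word) :
    ev (fun x => MulOpposite.op (g x)) w = MulOpposite.op (ev g w.reverse) := by
  induction w with
  | nil => rfl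
  | cons x w ih => simp [ih]

/-- The submonoid generated by the letters in `X`. -/
def gen (g : ℕ → M) (X : List ℕ) : Submonoid M := Submonoid.closure (g '' {x | x ∈ X})

/-- The two-sided ideal generated by a word. -/
def ideal (g : ℕ → M) (f : Word) : Set M := {m | ∃ p q, m = p * ev g f * q}

lemma mem_gen {X : List ℕ} {x : ℕ} (hx : x ∈ X) : g x ∈ gen g X :=
  Submonoid.subset_closure ⟨x, hx, rfl⟩

lemma gen_induction {X : List ℕ} {p : M → Prop} (one : p 1)
    (mul : ∀ x ∈ X, ∀ m ∈ gen g X, p m → p (g x * m)) : ∀ m ∈ gen g X, p m := by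
  intro m hm
  induction hm using Submonoid.closure_induction_left with
  | one => exact one
  | mul_left y hy m hm ih =>
    obtain ⟨x, hx, rfl⟩ := hy
    exact mul x hx m hm ih

lemma ev_mem_gen {X : List ℕ} {w : Word} (hw : ∀ x ∈ w, x ∈ X) : ev g w ∈ gen g X :=
  list_prod_mem (by simpa using fun x hx => mem_gen (hw x hx))

lemma exists_coset {t : Trie} (ht : t.Sound g []) {X P : List ℕ} {D : List Word}
    (hc : checkCosets t X D P = true) (hD : [] ∈ D) :
    ∀ m ∈ gen g X, ∃ d ∈ D, ∃ n ∈ gen g P, m = ev g d * n := by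
  simp only [checkCosets, List.all_eq_true, Bool.or_eq_true] at hc
  refine gen_induction ⟨[], hD, 1, one_mem _, by simp⟩ ?_
  rintro x hx _ - ⟨d, hd, n, hn, rfl⟩
  rw [← mul_assoc, ← ev_cons]
  rcases hc d hd x hx with h | h
  · obtain ⟨d', hd', h⟩ := Trie.mem_sound ht h
    exact ⟨d', hd', n, hn, by rw [h]⟩
  · obtain ⟨w, hw, h⟩ := Trie.mem_sound ht h
    obtain ⟨p, hp, rfl⟩ := List.mem_map.1 hw
    exact ⟨d, hd, g p * n, mul_mem (mem_gen hp) hn, by simp [h, mul_assoc]⟩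

lemma ev_mem_ideal {f w : Word} (h : occurs f w = true) : ev g w ∈ ideal g f := by
  obtain ⟨p, q, rfl⟩ := occurs_sound h
  exact ⟨ev g p, ev g q, by simp [mul_assoc]⟩

lemma mul_mem_ideal {f : Word} {m : M} (h : m ∈ ideal g f) (p q : M) : p * m * q ∈ ideal g f := by
  obtain ⟨p', q', rfl⟩ := h
  exact ⟨p * p', q' * q, by simp [mul_assoc]⟩

lemma mul_left_mem_ideal {f : Word} {m : M} (h : m ∈ ideal g f) (p : M) : p * m ∈ ideal g f := by
  simpa using mul_mem_ideal h p 1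

lemma mul_right_mem_ideal {f : Word} {m : M} (h : m ∈ ideal g f) (q : M) : m * q ∈ ideal g f := by
  simpa using mul_mem_ideal h 1 q

lemma ideal_mono {f f' : Word} (h : ev g f ∈ ideal g f') : ideal g f ⊆ ideal g f' := by
  rintro _ ⟨p, q, rfl⟩
  exact mul_mem_ideal h p q

lemma mem_ideal_of_op {f : Word} {m : M}
    (h : MulOpposite.op m ∈ ideal (fun x => MulOpposite.op (g x)) f) : m ∈ ideal g f.reverse := by
  obtain ⟨p, q, h⟩ := h
  refine ⟨q.unop, p.unop, MulOpposite.op_injective ?_⟩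
  rw [h, ev_op]
  simp [mul_assoc]

namespace IsModel

lemma exists_trie (hg : IsModel g) :
    ∃ t : Trie, t.Sound g [] ∧ checkOpp t = true ∧ checkGen t = true ∧
    checkE1E3 t = true ∧ checkE1 t = true ∧ checkSym t = true ∧ checkConj t = true ∧
    checkE3 t = true ∧ checkCosets t [0, 1, 2, 3] cosets₁ [1, 2, 3] = true ∧
    checkCosets t [1, 2, 3] cosets₂ [1, 2] = true ∧ checkCosets t [1, 2] cosets₃ [2] = true := by
  obtain ⟨t, ht, hc⟩ := exists_sound_trie hg.ev_eq
  exact ⟨t, ht, by simpa only [check, Bool.and_eq_true, and_assoc] using hc⟩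

lemma op (hg : IsModel g) : IsModel fun x => MulOpposite.op (g x) where
  ev_eq p hp := by
    obtain ⟨t, ht, hc, -⟩ := hg.exists_trie
    rw [ev_op, ev_op, Trie.eqv_sound ht (List.all_eq_true.1 hc p hp)]
  eq_one x hx := by simp [hg.eq_one x hx]
  surj m := by
    obtain ⟨w, hw⟩ := hg.surj m.unop
    exact ⟨w.reverse, by simp [ev_op, hw]⟩

lemma special_eqs (hg : IsModel g) :
    ev g [5] = ev g [0, 1, 4, 1, 0] ∧ ev g [7] = ev g [2, 3, 6, 3, 2] ∧
    ev g [4, 7] = ev g [2, 3, 4, 6, 3, 2] ∧ ev g [6, 1, 6] = ev g [1, 6, 0, 1, 4, 1, 0, 6] ∧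
    ev g [4, 6] = ev g [4, 6, 6, 4] := by
  obtain ⟨t, ht, -, hc, -⟩ := hg.exists_trie
  simp only [checkGen, Bool.and_eq_true] at hc
  refine ⟨?_, ?_, ?_, ?_, ?_⟩ <;> exact Trie.eqv_sound ht (by simp_all)

lemma induction (hg : IsModel g) {p : M → Prop} (one : p 1)
    (mul : ∀ x ∈ [0, 1, 2, 3, 4, 6], ∀ m, p m → p (g x * m)) (m : M) : p m := by
  obtain ⟨w, rfl⟩ := hg.surj m
  obtain ⟨special, special', -⟩ := hg.special_eqs
  simp only [ev_cons, ev_nil, mul_one] at special special'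
  induction w with
  | nil => exact one
  | cons x w ih =>
    have mul' : ∀ v : Word, (∀ y ∈ v, y ∈ [0, 1, 2, 3, 4, 6]) → p (ev g v * ev g w) := by
      intro v hv
      induction v with
      | nil => simpa using ih
      | cons y v ih' =>
        rw [List.forall_mem_cons] at hv
        simpa [mul_assoc] using mul y hv.1 _ (ih' hv.2)
    rcases lt_or_ge x 8 with hx | hx
    · by_cases h5 : x = 5
      · simpa [h5, mul_assoc, special] using mul' [0, 1, 4, 1, 0] (by decide)
      by_cases h7 : x = 7
      · simpa [h7, mul_assoc, special'] using mul' [2, 3, 6, 3, 2] (by decide)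
      simpa using mul x (by simp; omega) _ ih
    · simpa [hg.eq_one x hx] using ih

lemma ideal_e1e4 (hg : IsModel g) : ideal g [4, 7] ⊆ ideal g [4, 6] :=
  ideal_mono (by rw [hg.special_eqs.2.2.1]; exact ev_mem_ideal (by decide))

lemma ideal_e3r2e3 (hg : IsModel g) : ideal g [6, 1, 6] ⊆ ideal g [4] :=
  ideal_mono (by rw [hg.special_eqs.2.2.2.1]; exact ev_mem_ideal (by decide))

lemma ideal_e3e1 (hg : IsModel g) : ideal g [6, 4] ⊆ ideal g [4, 6] :=
  ideal_mono (by rw [hg.ev_eq ([6, 4], [4, 6]) (by decide)]; exact ev_mem_ideal (by decide))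

lemma mul_e1e3 (hg : IsModel g) (m : M) : ∃ w ∈ leftE1E3, m * ev g [4, 6] = ev g w := by
  obtain ⟨t, ht, -, -, hc, -⟩ := hg.exists_trie
  simp only [checkE1E3, List.all_eq_true] at hc
  induction m using hg.induction with
  | one => exact ⟨[4, 6], by decide, one_mul _⟩
  | mul x hx m ih =>
    obtain ⟨w, hw, h⟩ := ih
    rw [mul_assoc, h, ← ev_cons]
    exact Trie.mem_sound ht (hc w hw x hx)

lemma e1e3_mul (hg : IsModel g) (m : M) : ∃ w ∈ leftE1E3, ev g [6, 4] * m = ev g w.reverse := by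
  obtain ⟨w, hw, h⟩ := hg.op.mul_e1e3 (.op m)
  rw [ev_op, ev_op] at h
  exact ⟨w, hw, MulOpposite.op_injective h⟩

lemma mul_e1 (hg : IsModel g) (m : M) : m * g 4 ∈ ideal g [4, 6] ∨
    ∃ v ∈ leftE1, ∃ h ∈ symE1, m * g 4 = ev g (v ++ (h ++ [4])) := by
  obtain ⟨t, ht, -, -, -, hE, hS, -⟩ := hg.exists_trie
  simp only [checkE1, checkSym, Bool.and_eq_true, Bool.or_eq_true, List.all_eq_true,
    List.any_eq_true] at hE hS
  induction m using hg.induction with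
  | one => exact .inr ⟨[], by decide, [], by decide, by simp⟩
  | mul x hx m ih =>
    rw [mul_assoc]
    rcases ih with ih | ⟨v, hv, h, hh, ih⟩
    · exact .inl (mul_left_mem_ideal ih _)
    have key : g x * (m * g 4) = ev g (x :: (v ++ [4])) * ev g h := by
      have := Trie.eqv_sound ht (hS h hh).1
      simp only [ev_append, ev_cons, ev_nil, mul_one] at this
      simp [ih, this, mul_assoc]
    rw [key]
    rcases hE v hv x hx with (hE | hE) | ⟨v', hv', hE⟩
    · rw [← Trie.nf_sound ht]
      exact .inl (mul_right_mem_ideal (ev_mem_ideal hE) _)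
    · rw [← Trie.nf_sound ht]
      exact .inl (mul_right_mem_ideal (hg.ideal_e1e4 (ev_mem_ideal hE)) _)
    · right
      obtain ⟨w, hw, hE⟩ := Trie.mem_sound ht hE
      obtain ⟨h', hh', rfl⟩ := List.mem_map.1 hw
      obtain ⟨h'', hh'', hS'⟩ := Trie.mem_sound ht ((hS h' hh').2 h hh)
      have := Trie.eqv_sound ht (hS h hh).1
      simp only [ev_append, ev_cons, ev_nil, mul_one] at this hS'
      exact ⟨v', hv', h'', hh'', by simp [hE, mul_assoc, ← this, ← hS']⟩

lemma mul_e1_eq_mul (hg : IsModel g) (m : M) : m * g 4 ∈ ideal g [4, 6] ∨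
    ∃ v ∈ leftE1, ∃ n, m * g 4 = ev g v * g 4 * n := by
  obtain ⟨t, ht, -, -, -, -, hS, -⟩ := hg.exists_trie
  simp only [checkSym, Bool.and_eq_true, List.all_eq_true] at hS
  refine (hg.mul_e1 m).imp_right ?_
  rintro ⟨v, hv, h, hh, hm⟩
  have := Trie.eqv_sound ht (hS h hh).1
  simp only [ev_append, ev_cons, ev_nil, mul_one] at this
  exact ⟨v, hv, ev g h, by simp [hm, this, mul_assoc]⟩

lemma e1_mul (hg : IsModel g) (m : M) : g 4 * m ∈ ideal g [4, 6] ∨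
    ∃ v ∈ leftE1, ∃ n, g 4 * m = n * g 4 * ev g v.reverse := by
  rcases hg.op.mul_e1_eq_mul (.op m) with h | ⟨v, hv, n, h⟩
  · exact .inl (hg.ideal_e3e1 (mem_ideal_of_op h))
  · rw [ev_op] at h
    exact .inr ⟨v, hv, n.unop,
      MulOpposite.op_injective (by rw [MulOpposite.op_mul, h]; simp [mul_assoc])⟩

lemma ev_mul_ev_reverse (hg : IsModel g) {w : Word} (hw : ∀ x ∈ w, x ∈ [0, 1, 2, 3]) :
    ev g w * ev g w.reverse = 1 := by
  have sq : ∀ x ∈ [0, 1, 2, 3], g x * g x = 1 := fun x hx => by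
    simpa using hg.ev_eq ([x, x], []) (by revert x; decide)
  induction w with
  | nil => simp
  | cons x w ih =>
    rw [List.forall_mem_cons] at hw
    calc _ = g x * (ev g w * ev g w.reverse) * g x := by simp [mul_assoc]
      _ = 1 := by rw [ih hw.2, mul_one, sq x hw.1]

lemma exists_conj (hg : IsModel g) :
    ∀ m ∈ gen g [0, 1, 2, 3], ∃ u ∈ conjE3, ∃ n ∈ gen g [0, 1, 2, 3],
    n * g 6 = g 6 * n ∧ m = ev g u * n := by
  obtain ⟨t, ht, -, -, -, -, -, hc, -⟩ := hg.exists_trie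
  simp only [checkConj, List.all_eq_true, List.any_eq_true] at hc
  have conj_letters : ∀ u ∈ conjE3, ∀ x ∈ u, x ∈ [0, 1, 2, 3] := by decide
  refine gen_induction ⟨[], by decide, 1, one_mem _, by simp, by simp⟩ ?_
  rintro x hx _ - ⟨u, hu, n, hn, hcomm, rfl⟩
  obtain ⟨u', hu', h⟩ := hc u hu x hx
  have h := Trie.eqv_sound ht h
  simp only [ev_append, ev_cons, ev_nil, mul_one] at h
  refine ⟨u', hu', ev g u'.reverse * (g x * ev g u) * n, ?_, ?_, ?_⟩
  · refine mul_mem (mul_mem (ev_mem_gen ?_) (mul_mem (mem_gen hx) (ev_mem_gen ?_))) hn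
    · simpa using conj_letters u' hu'
    · exact conj_letters u hu
  · rw [mul_assoc, hcomm, ← mul_assoc, mul_assoc (ev g _), mul_assoc (g x), h]
    simp only [mul_assoc]
  · rw [mul_assoc, ← mul_assoc (ev g u'), hg.ev_mul_ev_reverse (conj_letters u' hu'), one_mul,
      mul_assoc]

lemma mul_e3 (hg : IsModel g) (m : M) :
    m * g 6 ∈ ideal g [4] ∨ ∃ w ∈ gen g [0, 1, 2, 3], m * g 6 = w * g 6 := by
  obtain ⟨t, ht, -, -, -, -, -, -, hc, -⟩ := hg.exists_trie
  simp only [checkE3, Bool.or_eq_true, List.all_eq_true] at hc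
  have conj_letters : ∀ u ∈ conjE3, ∀ x ∈ u, x ∈ [0, 1, 2, 3] := by decide
  induction m using hg.induction with
  | one => exact .inr ⟨1, one_mem _, rfl⟩
  | mul x hx m ih =>
    rw [mul_assoc]
    rcases ih with ih | ⟨w, hw, ih⟩
    · exact .inl (mul_left_mem_ideal ih _)
    by_cases hx' : x ∈ [0, 1, 2, 3]
    · exact .inr ⟨g x * w, mul_mem (mem_gen hx') hw, by rw [ih, mul_assoc]⟩
    obtain rfl | rfl : x = 4 ∨ x = 6 := by simp at hx hx'; omega
    · exact .inl ⟨1, m * g 6, by simp⟩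
    obtain ⟨u, hu, n, hn, hcomm, rfl⟩ := hg.exists_conj w hw
    have key : g 6 * (m * g 6) = ev g (6 :: (u ++ [6])) * n := by simp [ih, mul_assoc, hcomm]
    rw [key]
    rcases hc u hu with (h | h) | h
    · rw [← Trie.nf_sound ht]
      exact .inl (mul_right_mem_ideal (ev_mem_ideal h) _)
    · rw [← Trie.nf_sound ht]
      exact .inl (mul_right_mem_ideal (hg.ideal_e3r2e3 (ev_mem_ideal h)) _)
    · right
      have hu := ev_mem_gen (g := g) (conj_letters u hu)
      have hu' : ev g u.reverse ∈ gen g [0, 1, 2, 3] :=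
        ev_mem_gen (by simpa using conj_letters u ‹_›)
      have h2 : g 2 ∈ gen g [0, 1, 2, 3] := mem_gen (by decide)
      obtain ⟨v, hv, h⟩ := Trie.mem_sound ht h
      rw [h]
      simp only [List.mem_cons, List.not_mem_nil, or_false] at hv
      rcases hv with rfl | rfl
      · exact ⟨ev g u * n, mul_mem hu hn, by simp [mul_assoc, hcomm]⟩
      · exact ⟨ev g u * (g 2 * (ev g u.reverse * (g 2 * (ev g u * n)))),
          mul_mem hu (mul_mem h2 (mul_mem hu' (mul_mem h2 (mul_mem hu hn)))),
          by simp [mul_assoc, hcomm]⟩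

lemma mul_e3_eq_mul (hg : IsModel g) (m : M) : m * g 6 ∈ ideal g [4] ∨
    ∃ u ∈ conjE3, ∃ n, m * g 6 = ev g u * g 6 * n := by
  refine (hg.mul_e3 m).imp_right ?_
  rintro ⟨w, hw, h⟩
  obtain ⟨u, hu, n, -, hcomm, rfl⟩ := hg.exists_conj w hw
  exact ⟨u, hu, n, by simp [h, mul_assoc, hcomm]⟩

lemma e3_mul (hg : IsModel g) (m : M) : g 6 * m ∈ ideal g [4] ∨
    ∃ u ∈ conjE3, ∃ n, g 6 * m = n * g 6 * ev g u.reverse := by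
  rcases hg.op.mul_e3_eq_mul (.op m) with h | ⟨u, hu, n, h⟩
  · exact .inl (mem_ideal_of_op h)
  · rw [ev_op] at h
    exact .inr ⟨u, hu, n.unop,
      MulOpposite.op_injective (by rw [MulOpposite.op_mul, h]; simp [mul_assoc])⟩

lemma mem_gen_or_mem_ideal (hg : IsModel g) (m : M) :
    m ∈ gen g [0, 1, 2, 3] ∨ m ∈ ideal g [6] ∨ m ∈ ideal g [4] := by
  induction m using hg.induction with
  | one => exact .inl (one_mem _)
  | mul x hx m ih =>
    rcases ih with ih | ih | ih
    · by_cases hx' : x ∈ [0, 1, 2, 3]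
      · exact .inl (mul_mem (mem_gen hx') ih)
      obtain rfl | rfl : x = 4 ∨ x = 6 := by simp at hx hx'; omega
      · exact .inr (.inr ⟨1, m, by simp⟩)
      · exact .inr (.inl ⟨1, m, by simp⟩)
    · exact .inr (.inl (mul_left_mem_ideal ih _))
    · exact .inr (.inr (mul_left_mem_ideal ih _))

lemma exists_weyl (hg : IsModel g) : ∀ m ∈ gen g [0, 1, 2, 3],
    ∃ k ∈ weyl, m = ev g k ∨ m = ev g (k ++ [2]) := by
  obtain ⟨t, ht, -, -, -, -, -, -, -, h₁, h₂, h₃⟩ := hg.exists_trie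
  intro m hm
  obtain ⟨a, ha, n, hn, rfl⟩ := exists_coset ht h₁ (by decide) m hm
  obtain ⟨b, hb, n', hn', rfl⟩ := exists_coset ht h₂ (by decide) n hn
  obtain ⟨c, hc, n'', hn'', rfl⟩ := exists_coset ht h₃ (by decide) n' hn'
  refine ⟨a ++ (b ++ c), List.mem_map.2 ⟨(a, b, c), by simp [ha, hb, hc], rfl⟩, ?_⟩
  have hn : n'' = 1 ∨ n'' = g 2 := by
    refine gen_induction (p := fun n => n = 1 ∨ n = g 2) (.inl rfl) ?_ n'' hn''
    rintro x hx _ - (rfl | rfl)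
    · simp_all
    · have := hg.ev_eq ([2, 2], []) (by decide)
      simp_all
  rcases hn with rfl | rfl <;> simp

lemma exists_weyl_mul_e3 (hg : IsModel g) {m : M} (hm : m ∈ gen g [0, 1, 2, 3]) :
    ∃ k ∈ weyl, m * g 6 = ev g k * g 6 := by
  obtain ⟨k, hk, rfl | rfl⟩ := hg.exists_weyl m hm
  · exact ⟨k, hk, rfl⟩
  · have := hg.ev_eq ([2, 6], [6]) (by decide)
    simp only [ev_cons, ev_nil, mul_one] at this
    exact ⟨k, hk, by simp [mul_assoc, this]⟩

/-- Every element of a model is the value of one of the words in `spanningWords`. -/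
theorem exists_spanningWord (hg : IsModel g) (m : M) : ∃ w ∈ spanningWords, m = ev g w := by
  have mem_e1e3 : ∀ m ∈ ideal g [4, 6], ∃ w ∈ spanningWords, m = ev g w := by
    rintro _ ⟨p, q, rfl⟩
    obtain ⟨v, hv, hp⟩ := hg.mul_e1e3 p
    obtain ⟨w, hw, hq⟩ := hg.e1e3_mul q
    refine ⟨v ++ w.reverse, ?_, ?_⟩
    · simp only [spanningWords, List.mem_append, List.mem_map]
      exact .inr ⟨(v, w), by simp [hv, hw], rfl⟩
    · have : ev g [4, 6] = ev g [4, 6] * ev g [6, 4] := by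
        rw [← ev_append]
        exact hg.special_eqs.2.2.2.2
      rw [this, ← mul_assoc, hp, mul_assoc, hq, ev_append]
  have mem_e1 : ∀ m ∈ ideal g [4], ∃ w ∈ spanningWords, m = ev g w := by
    rintro _ ⟨p, q, rfl⟩
    rw [show ev g [4] = g 4 by simp]
    rcases hg.e1_mul q with hq | ⟨w, hw, n, hq⟩
    · exact mem_e1e3 _ (by simpa [mul_assoc] using mul_left_mem_ideal hq p)
    have key : p * g 4 * q = p * n * g 4 * ev g w.reverse := by simp [mul_assoc, hq]
    rw [key]
    rcases hg.mul_e1 (p * n) with hp | ⟨v, hv, h, hh, hp⟩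
    · exact mem_e1e3 _ (mul_right_mem_ideal hp _)
    refine ⟨v ++ (h ++ 4 :: w.reverse), ?_, by simp [hp, mul_assoc]⟩
    simp only [spanningWords, List.mem_append, List.mem_map]
    exact .inl (.inr ⟨(v, h, w), by simp [hv, hh, hw], rfl⟩)
  rcases hg.mem_gen_or_mem_ideal m with hm | ⟨p, q, rfl⟩ | hm
  · obtain ⟨k, hk, hm⟩ := hg.exists_weyl m hm
    simp only [spanningWords, List.mem_append, List.mem_map]
    rcases hm with rfl | rfl
    · exact ⟨k, .inl (.inl (.inl (.inl hk))), rfl⟩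
    · exact ⟨k ++ [2], .inl (.inl (.inl (.inr ⟨k, hk, rfl⟩))), rfl⟩
  · rw [show ev g [6] = g 6 by simp]
    rcases hg.e3_mul q with hq | ⟨u, hu, n, hq⟩
    · exact mem_e1 _ (by simpa [mul_assoc] using mul_left_mem_ideal hq p)
    have key : p * g 6 * q = p * n * g 6 * ev g u.reverse := by simp [mul_assoc, hq]
    rw [key]
    rcases hg.mul_e3 (p * n) with hp | ⟨w, hw, hp⟩
    · exact mem_e1 _ (mul_right_mem_ideal hp _)
    obtain ⟨k, hk, hw⟩ := hg.exists_weyl_mul_e3 hw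
    refine ⟨k ++ 6 :: u.reverse, ?_, by simp [hp, hw, mul_assoc]⟩
    simp only [spanningWords, List.mem_append, List.mem_map]
    exact .inl (.inl (.inr ⟨(k, u), by simp [hk, hu], rfl⟩))
  · exact mem_e1 m hm

end IsModel

end Model

/-! ### The Brauer algebra -/

open BrF4rel

/-- Equality up to a unit of the ground ring. -/
def unitCon : Con BrF4 where
  r x y := ∃ u : Rringˣ, x = u • y
  iseqv := by
    refine ⟨fun x => ⟨1, (one_smul _ x).symm⟩, ?_, ?_⟩
    · rintro x y ⟨u, rfl⟩
      exact ⟨u⁻¹, (inv_smul_smul u y).symm⟩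
    · rintro x y z ⟨u, rfl⟩ ⟨v, rfl⟩
      exact ⟨u * v, smul_smul u v z⟩
  mul' := by
    rintro w x y z ⟨u, rfl⟩ ⟨v, rfl⟩
    exact ⟨u * v, smul_mul_smul_comm u x v z⟩

/-- The letters as elements of the free algebra. -/
noncomputable def letter : ℕ → FreeAlgebra Rring GenF4
  | 0 => R 0
  | 1 => R 1
  | 2 => R 2
  | 3 => R 3
  | 4 => E 0
  | 5 => E 1
  | 6 => E 2
  | 7 => E 3
  | _ => 1

/-- The letters as elements of the Brauer algebra. -/
noncomputable def brauerLetter (x : ℕ) : BrF4 := RingQuot.mkAlgHom Rring rel (letter x)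

lemma ev_brauerLetter (w : Word) :
    ev brauerLetter w = RingQuot.mkAlgHom Rring rel (ev letter w) := by
  induction w with
  | nil => simp
  | cons x w ih => simp [ih, brauerLetter]

/-- The unit `δ`. -/
noncomputable def deltaUnit : Rringˣ where
  val := δ
  inv := LaurentPolynomial.T (-1)
  val_inv := by rw [δ, ← LaurentPolynomial.T_add, add_neg_cancel, LaurentPolynomial.T_zero]
  inv_val := by rw [δ, ← LaurentPolynomial.T_add, neg_add_cancel, LaurentPolynomial.T_zero]

lemma exists_unit_of_rel (u : Rringˣ) {v w : Word} {a b : FreeAlgebra Rring GenF4}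
    (h : rel a ((u : Rring) • b)) (ha : ev letter v = a := by simp [letter, mul_assoc])
    (hb : ev letter w = b := by simp [letter, mul_assoc]) :
    ∃ u : Rringˣ, ev brauerLetter v = u • ev brauerLetter w :=
  ⟨u, by rw [ev_brauerLetter, ev_brauerLetter, ha, hb, RingQuot.mkAlgHom_rel Rring h, map_smul,
    Units.smul_def]⟩

lemma exists_unit_of_rel_one {v w : Word} {a b : FreeAlgebra Rring GenF4}
    (h : rel a b) (ha : ev letter v = a := by simp [letter, mul_assoc])
    (hb : ev letter w = b := by simp [letter, mul_assoc]) :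
    ∃ u : Rringˣ, ev brauerLetter v = u • ev brauerLetter w :=
  exists_unit_of_rel 1 (by rwa [Units.val_one, one_smul]) ha hb

lemma ev_brauerLetter_rels : ∀ p ∈ rels, ∃ u : Rringˣ,
    ev brauerLetter p.1 = u • ev brauerLetter p.2 := by
  have n02 : nadj 0 2 := by simp [nadj]
  have n20 : nadj 2 0 := by simp [nadj]
  have n03 : nadj 0 3 := by simp [nadj]
  have n30 : nadj 3 0 := by simp [nadj]
  have n13 : nadj 1 3 := by simp [nadj]
  have n31 : nadj 3 1 := by simp [nadj]
  have s01 : sadj 0 1 := by simp [sadj]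
  have s10 : sadj 1 0 := by simp [sadj]
  have s23 : sadj 2 3 := by simp [sadj]
  have s32 : sadj 3 2 := by simp [sadj]
  simp only [rels, List.forall_mem_cons]
  exact ⟨exists_unit_of_rel_one (.rr 0), exists_unit_of_rel_one (.re 0),
    exists_unit_of_rel_one (.er 0), exists_unit_of_rel (deltaUnit ^ 2) (.ee_long 0 (by simp)),
    exists_unit_of_rel_one (.rr 1), exists_unit_of_rel_one (.re 1),
    exists_unit_of_rel_one (.er 1), exists_unit_of_rel (deltaUnit ^ 2) (.ee_long 1 (by simp)),
    exists_unit_of_rel_one (.rr 2), exists_unit_of_rel_one (.re 2),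
    exists_unit_of_rel_one (.er 2), exists_unit_of_rel deltaUnit (.ee_short 2 (by simp)),
    exists_unit_of_rel_one (.rr 3), exists_unit_of_rel_one (.re 3),
    exists_unit_of_rel_one (.er 3), exists_unit_of_rel deltaUnit (.ee_short 3 (by simp)),
    exists_unit_of_rel_one (.rr_comm n02), exists_unit_of_rel_one (.er_comm n02),
    exists_unit_of_rel_one (.ee_comm n02), exists_unit_of_rel_one (.rr_comm n20),
    exists_unit_of_rel_one (.er_comm n20), exists_unit_of_rel_one (.ee_comm n20),
    exists_unit_of_rel_one (.rr_comm n03), exists_unit_of_rel_one (.er_comm n03),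
    exists_unit_of_rel_one (.ee_comm n03), exists_unit_of_rel_one (.rr_comm n30),
    exists_unit_of_rel_one (.er_comm n30), exists_unit_of_rel_one (.ee_comm n30),
    exists_unit_of_rel_one (.rr_comm n13), exists_unit_of_rel_one (.er_comm n13),
    exists_unit_of_rel_one (.ee_comm n13), exists_unit_of_rel_one (.rr_comm n31),
    exists_unit_of_rel_one (.er_comm n31), exists_unit_of_rel_one (.ee_comm n31),
    exists_unit_of_rel_one (.braid s01), exists_unit_of_rel_one (.rre s01),
    exists_unit_of_rel_one (.rer s01), exists_unit_of_rel_one (.braid s10),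
    exists_unit_of_rel_one (.rre s10), exists_unit_of_rel_one (.rer s10),
    exists_unit_of_rel_one (.braid s23), exists_unit_of_rel_one (.rre s23),
    exists_unit_of_rel_one (.rer s23), exists_unit_of_rel_one (.braid s32),
    exists_unit_of_rel_one (.rre s32), exists_unit_of_rel_one (.rer s32),
    exists_unit_of_rel_one .db1, exists_unit_of_rel_one .db2, exists_unit_of_rel_one .db3,
    exists_unit_of_rel_one .db4, exists_unit_of_rel deltaUnit .db5,
    exists_unit_of_rel deltaUnit .db6, exists_unit_of_rel_one .db7, exists_unit_of_rel_one .db8,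
    by simp⟩

/-- The class of a letter, in the monoid of all classes of words. -/
noncomputable def model : FreeMonoid ℕ →* unitCon.Quotient :=
  FreeMonoid.lift fun x => (brauerLetter x : unitCon.Quotient)

lemma model_ofList (w : Word) :
    model (FreeMonoid.ofList w) = ((ev brauerLetter w : BrF4) : unitCon.Quotient) := by
  induction w with
  | nil => rfl
  | cons x w ih => rw [FreeMonoid.ofList_cons, map_mul, ih, ev_cons, Con.coe_mul]; rfl

lemma ev_model (w : Word) :
    ev (fun x => model.mrangeRestrict (FreeMonoid.of x)) w =
      model.mrangeRestrict (FreeMonoid.ofList w) := by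
  induction w with
  | nil => rfl
  | cons x w ih => rw [ev_cons, ih, ← map_mul, FreeMonoid.ofList_cons]

lemma ev_model_eq_iff {v w : Word} :
    ev (fun x => model.mrangeRestrict (FreeMonoid.of x)) v =
      ev (fun x => model.mrangeRestrict (FreeMonoid.of x)) w ↔
    ∃ u : Rringˣ, ev brauerLetter v = u • ev brauerLetter w := by
  rw [ev_model, ev_model, Subtype.ext_iff, MonoidHom.coe_mrangeRestrict,
    MonoidHom.coe_mrangeRestrict, model_ofList, model_ofList, Con.eq]
  rfl

lemma isModel : IsModel fun x => model.mrangeRestrict (FreeMonoid.of x) where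
  ev_eq p hp := ev_model_eq_iff.2 (ev_brauerLetter_rels p hp)
  eq_one x hx := by
    have : ev (fun x => model.mrangeRestrict (FreeMonoid.of x)) [x] =
        ev (fun x => model.mrangeRestrict (FreeMonoid.of x)) [] := by
      refine ev_model_eq_iff.2 ⟨1, ?_⟩
      obtain ⟨y, rfl⟩ := Nat.exists_eq_add_of_le' hx
      simp [brauerLetter, letter]
    simpa using this
  surj m := by
    obtain ⟨w, rfl⟩ := model.mrangeRestrict_surjective m
    exact ⟨w.toList, by rw [ev_model, FreeMonoid.ofList_toList]⟩

lemma exists_ev_eq_smul (w : Word) : ∃ v ∈ spanningWords, ∃ u : Rringˣ,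
    ev brauerLetter w = u • ev brauerLetter v := by
  obtain ⟨v, hv, h⟩ := isModel.exists_spanningWord
    (ev (fun x => model.mrangeRestrict (FreeMonoid.of x)) w)
  exact ⟨v, hv, ev_model_eq_iff.1 h⟩

lemma span_words : Submodule.span Rring (Set.range (ev brauerLetter)) = ⊤ := by
  rw [eq_top_iff]
  rintro x -
  obtain ⟨a, rfl⟩ := RingQuot.mkAlgHom_surjective Rring rel x
  set N := Submodule.span Rring (Set.range (ev brauerLetter))
  have mul_mem {x y : BrF4} (hx : x ∈ N) (hy : y ∈ N) : x * y ∈ N := by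
    have h := Submodule.mul_mem_mul hx hy
    rw [Submodule.span_mul_span] at h
    refine Submodule.span_mono ?_ h
    rintro _ ⟨_, ⟨v, rfl⟩, _, ⟨w, rfl⟩, rfl⟩
    exact ⟨v ++ w, ev_append v w⟩
  have letter_mem (x : ℕ) : brauerLetter x ∈ N := Submodule.subset_span ⟨[x], by simp⟩
  induction a using FreeAlgebra.induction with
  | grade0 r =>
    rw [AlgHom.commutes, Algebra.algebraMap_eq_smul_one]
    exact N.smul_mem r (Submodule.subset_span ⟨[], rfl⟩)
  | grade1 x =>
    rcases x with i | i <;> fin_cases i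
    exacts [letter_mem 0, letter_mem 1, letter_mem 2, letter_mem 3, letter_mem 4, letter_mem 5,
      letter_mem 6, letter_mem 7]
  | mul a b ha hb => rw [map_mul]; exact mul_mem ha hb
  | add a b ha hb => rw [map_add]; exact N.add_mem ha hb

end BrF4Span

/-- `Br(F₄)` is spanned, as a `ℤ[δ,δ⁻¹]`-module, by a set of at most
`14985` elements. -/
theorem brF4_spanned_by_14985 :
    ∃ S : Finset BrF4, S.card ≤ 14985 ∧ Submodule.span Rring (S : Set BrF4) = ⊤ := by
  classical
  refine ⟨(BrF4Span.spanningWords.map (BrF4Span.ev BrF4Span.brauerLetter)).toFinset, ?_, ?_⟩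
  · refine (List.toFinset_card_le _).trans ?_
    rw [List.length_map, BrF4Span.length_spanningWords]
  · rw [eq_top_iff, ← BrF4Span.span_words, Submodule.span_le]
    rintro _ ⟨w, rfl⟩
    obtain ⟨v, hv, u, h⟩ := BrF4Span.exists_ev_eq_smul w
    rw [SetLike.mem_coe, h]
    refine Submodule.smul_mem _ (u : Rring) (Submodule.subset_span ?_)
    simpa using ⟨v, hv, rfl⟩
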